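/- Let T be a complete arithmetically definable theory in a countable arithmetically definable language with no finite models, and assume T is arithmetically stable and has no Vaughtian pairs. Let P ⊨ T be an arithmetically decidable prime model. Then there is a formula φ(x, p̄), with parameters p̄ from P, such that φ(x, p̄) is strongly minimal over P. -/

import Mathlib

open FirstOrder FirstOrder.Language

namespace ArMorley

/-! ## Arithmetical sets and arithmetic reducibility -/

/-- Function symbols of the language of arithmetic: `0`, `1`, `+`, `·`. -/
inductive ArFunc : ℕ → Type
  | zero : ArFunc 0
  | one : ArFunc 0
  | add : ArFunc 2
  | mul : ArFunc 2

/-- Relation symbols: `<` and a unary oracle predicate. -/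
inductive ArRel : ℕ → Type
  | lt : ArRel 2
  | mem : ArRel 1

/-- The language `(+, ·, 0, 1, <, Y)` of arithmetic with a unary oracle predicate. -/
def arithLang : FirstOrder.Language := ⟨ArFunc, ArRel⟩

/-- The standard structure on `ℕ`, with the oracle predicate interpreted by `Y`. -/
def arithStructure (Y : Set ℕ) : arithLang.Structure ℕ where
  funMap := fun {n} f =>
    match f with
    | ArFunc.zero => fun _ => 0
    | ArFunc.one => fun _ => 1
    | ArFunc.add => fun v => v 0 + v 1
    | ArFunc.mul => fun v => v 0 * v 1
  RelMap := fun {n} r =>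
    match r with
    | ArRel.lt => fun v => v 0 < v 1
    | ArRel.mem => fun v => v 0 ∈ Y

/-- `X ≤_ar Y` : `X` is definable without parameters in `(ℕ, +, ·, 0, 1, <, Y)`. -/
def ArReducible (X Y : Set ℕ) : Prop :=
  letI := arithStructure Y
  ∃ φ : arithLang.Formula (Fin 1), X = { n : ℕ | φ.Realize (fun _ => n) }

/-- `X` is arithmetical: definable without parameters in `(ℕ, +, ·, 0, 1, <)`. -/
def IsArithmetical (X : Set ℕ) : Prop := ArReducible X ∅

/-- `X` and `Y` have the same arithmetic degree. -/
def ArEquiv (X Y : Set ℕ) : Prop := ArReducible X Y ∧ ArReducible Y X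

/-! ## Coding conventions -/

/-- Code of a list of naturals. -/
def listCode (l : List ℕ) : ℕ := Encodable.encode l

/-- Code of a finite tuple of naturals. -/
def tupleCode {n : ℕ} (v : Fin n → ℕ) : ℕ := listCode (List.ofFn v)

/-- The subset of `ℕ` corresponding to a set of elements of a coded domain. -/
def subCode {A : Set ℕ} (S : Set ↥A) : Set ℕ := Subtype.val '' S

/-- Code of a set of `n`-tuples from a coded domain as a subset of `ℕ`. -/
def tupleSetCode {A : Set ℕ} {n : ℕ} (X : Set (Fin n → ↥A)) : Set ℕ :=
  { c : ℕ | ∃ v ∈ X, c = tupleCode (fun i => ((v i : ℕ))) }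

/-- Code of the graph of a function between coded domains. -/
def graphCode {A B : Set ℕ} (f : ↥A → ↥B) : Set ℕ :=
  { c : ℕ | ∃ a : ↥A, c = Nat.pair (a : ℕ) ((f a : ℕ)) }

/-! ## Gödel coded languages -/

/-- A fixed Gödel coding of the symbols of a countable first-order language. -/
structure GoedelCoding (L : FirstOrder.Language) where
  encFun : ∀ n, L.Functions n → ℕ
  encFun_inj : ∀ n, Function.Injective (encFun n)
  encRel : ∀ n, L.Relations n → ℕ
  encRel_inj : ∀ n, Function.Injective (encRel n)

variable {L : FirstOrder.Language}

/-- The set of codes of the symbols of `L`. -/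
def symbolCodes (g : GoedelCoding L) : Set ℕ :=
  { c | (∃ (n : ℕ) (f : L.Functions n), c = Nat.pair 0 (Nat.pair n (g.encFun n f))) ∨
        (∃ (n : ℕ) (R : L.Relations n), c = Nat.pair 1 (Nat.pair n (g.encRel n R))) }

/-- `L` is an arithmetically definable language. -/
def ArithLang (g : GoedelCoding L) : Prop := IsArithmetical (symbolCodes g)

/-- Code of a term, with a given coding of the variables. -/
def termCode (g : GoedelCoding L) {α : Type} (encα : α → ℕ) (t : L.Term α) : ℕ :=
  listCode (t.listEncode.map (Sum.elim (fun a => Nat.pair 0 (encα a))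
    (fun p => Nat.pair 1 (Nat.pair p.1 (g.encFun p.1 p.2)))))

/-- Code of a (bounded) formula, with a given coding of free variables. -/
def formulaCode (g : GoedelCoding L) {α : Type} (encα : α → ℕ) {n : ℕ}
    (φ : L.BoundedFormula α n) : ℕ :=
  listCode (φ.listEncode.map (Sum.elim
    (fun p => Nat.pair 0 (Nat.pair p.1
      (termCode g (Sum.elim (fun a => Nat.pair 0 (encα a)) (fun i => Nat.pair 1 i.1)) p.2)))
    (Sum.elim
      (fun q => Nat.pair 1 (Nat.pair q.1 (g.encRel q.1 q.2)))
      (fun m => Nat.pair 2 m))))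

/-- Code of a sentence. -/
def sentenceCode (g : GoedelCoding L) (φ : L.Sentence) : ℕ :=
  formulaCode g (fun a : Empty => a.elim) φ

/-- The set of codes of the axioms of a theory. -/
def theoryCode (g : GoedelCoding L) (T : L.Theory) : Set ℕ :=
  { c | ∃ φ ∈ T, c = sentenceCode g φ }

/-- `T` is an arithmetically definable theory. -/
def ArithTheory (g : GoedelCoding L) (T : L.Theory) : Prop := IsArithmetical (theoryCode g T)

/-! ## Coded structures -/

/-- A coded `L`-structure: an `L`-structure whose domain is a subset of `ℕ`
with infinite complement. -/
structure CodedStructure (L : FirstOrder.Language) where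
  carrier : Set ℕ
  compl_infinite : (carrierᶜ : Set ℕ).Infinite
  struc : L.Structure ↥carrier

/-- A coded structure is a model of `T`. -/
def CodedStructure.Models (M : CodedStructure L) (T : L.Theory) : Prop :=
  ∀ φ ∈ T, @Sentence.Realize L ↥M.carrier M.struc φ

/-- The (coded) elementary diagram of a coded structure. -/
def elemDiagram (g : GoedelCoding L) (M : CodedStructure L) : Set ℕ :=
  { c | ∃ (k : ℕ) (φ : L.Formula (Fin k)) (a : Fin k → ↥M.carrier),
      c = Nat.pair (Nat.pair k (formulaCode g Fin.val φ)) (tupleCode fun i => ((a i : ℕ))) ∧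
      (letI := M.struc; φ.Realize a) }

/-- A coded structure is arithmetically decidable if its elementary diagram is arithmetical. -/
def ArithDecidable (g : GoedelCoding L) (M : CodedStructure L) : Prop :=
  IsArithmetical (elemDiagram g M)

/-- `M ≼ N` for coded structures: `M`'s domain is contained in `N`'s, and the
inclusion is elementary. -/
structure ElemSub (M N : CodedStructure L) : Prop where
  subset : M.carrier ⊆ N.carrier
  elem : ∀ (k : ℕ) (φ : L.Formula (Fin k)) (a : Fin k → ↥M.carrier),
    (letI := M.struc; φ.Realize a) ↔
      (letI := N.struc; φ.Realize (fun i => (⟨((a i : ℕ)), subset (a i).2⟩ : ↥N.carrier)))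

/-- A coded model of `T` is arithmetically extendible if it is an elementary substructure of
an arithmetically decidable coded model of `T`. -/
def ArithExtendible (g : GoedelCoding L) (T : L.Theory) (M : CodedStructure L) : Prop :=
  ∃ N : CodedStructure L, ArithDecidable g N ∧ N.Models T ∧ ElemSub M N

/-! ## Model-theoretic notions in arbitrary structures -/

/-- `N` (with structure `SN`) is a model of `T`. -/
def ModelsT (L : FirstOrder.Language) (T : L.Theory) (N : Type) (SN : L.Structure N) : Prop :=
  ∀ φ ∈ T, @Sentence.Realize L N SN φ

/-- `T` has no finite models. -/
def NoFiniteModels (L : FirstOrder.Language) (T : L.Theory) : Prop :=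
  ∀ (N : Type) (SN : L.Structure N), ModelsT L T N SN → Infinite N

/-- Elementary embeddings, with the structures given explicitly. -/
def EEmb (L : FirstOrder.Language) (M : Type) (SM : L.Structure M)
    (N : Type) (SN : L.Structure N) : Type _ :=
  @FirstOrder.Language.ElementaryEmbedding L M N SM SN

/-- The underlying map of an elementary embedding. -/
def EEmb.fn {L : FirstOrder.Language} {M : Type} {SM : L.Structure M}
    {N : Type} {SN : L.Structure N} (j : EEmb L M SM N SN) : M → N :=
  @FirstOrder.Language.ElementaryEmbedding.toFun L M N SM SN j

/-- A subset of `N^n` definable with parameters from `P`. -/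
def DefinableOverT (L : FirstOrder.Language) (N : Type) (SN : L.Structure N) (P : Set N)
    {n : ℕ} (X : Set (Fin n → N)) : Prop :=
  letI := SN
  ∃ (m : ℕ) (ψ : L.Formula (Fin n ⊕ Fin m)) (b : Fin m → N),
    (∀ i, b i ∈ P) ∧ X = { v | ψ.Realize (Sum.elim v b) }

/-- A subset of `N` definable with (arbitrary) parameters. -/
def Definable1 (L : FirstOrder.Language) (N : Type) (SN : L.Structure N) (Y : Set N) : Prop :=
  letI := SN
  ∃ (m : ℕ) (ψ : L.Formula (Fin 1 ⊕ Fin m)) (b : Fin m → N),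
    Y = { x : N | ψ.Realize (Sum.elim (fun _ => x) b) }

/-- The algebraic closure of `B` in `N`: elements satisfying a formula with parameters
from `B` having finitely many solutions. -/
def aclIn (L : FirstOrder.Language) (N : Type) (SN : L.Structure N) (B : Set N) : Set N :=
  letI := SN
  { a : N | ∃ (k : ℕ) (φ : L.Formula (Fin 1 ⊕ Fin k)) (b : Fin k → N),
      (∀ i, b i ∈ B) ∧ φ.Realize (Sum.elim (fun _ => a) b) ∧
      { x : N | φ.Realize (Sum.elim (fun _ => x) b) }.Finite }

/-- The domain of the substructure of `N` generated by `B`: values of terms at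
arguments from `B`. -/
def genSub (L : FirstOrder.Language) (N : Type) (SN : L.Structure N) (B : Set N) : Set N :=
  letI := SN
  { a : N | ∃ (t : L.Term ℕ) (v : ℕ → N), (∀ i, v i ∈ B) ∧ a = t.realize v }

/-- The set defined by a formula `φ(x, p̄)` in one free variable with parameters `p̄`. -/
def smSet (L : FirstOrder.Language) (N : Type) (SN : L.Structure N) {k : ℕ}
    (φ : L.Formula (Fin 1 ⊕ Fin k)) (p : Fin k → N) : Set N :=
  letI := SN
  { x : N | φ.Realize (Sum.elim (fun _ => x) p) }

/-- A definable tuple-set in a coded structure, with parameters from `P`. -/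
def DefinableOver (M : CodedStructure L) (P : Set ↥M.carrier) {n : ℕ}
    (X : Set (Fin n → ↥M.carrier)) : Prop :=
  DefinableOverT L ↥M.carrier M.struc P X

/-- A definable tuple-set in a coded structure, with arbitrary parameters. -/
def DefinableIn (M : CodedStructure L) {n : ℕ} (X : Set (Fin n → ↥M.carrier)) : Prop :=
  DefinableOver M Set.univ X

/-! ## Isomorphisms of coded structures and `D`-categoricity -/

/-- An isomorphism of coded `L`-structures. -/
structure CodedIso (M N : CodedStructure L) where
  toFun : ↥M.carrier → ↥N.carrier
  invFun : ↥N.carrier → ↥M.carrier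
  left_inv : Function.LeftInverse invFun toFun
  right_inv : Function.RightInverse invFun toFun
  map_fun : ∀ {k : ℕ} (f : L.Functions k) (v : Fin k → ↥M.carrier),
    toFun (M.struc.funMap f v) = N.struc.funMap f (toFun ∘ v)
  map_rel : ∀ {k : ℕ} (r : L.Relations k) (v : Fin k → ↥M.carrier),
    M.struc.RelMap r v ↔ N.struc.RelMap r (toFun ∘ v)

/-- `f` is a `D`-preserving isomorphism, where `d` is a representative of the
arithmetic degree `D`. -/
def DPreserving (d : Set ℕ) {M N : CodedStructure L} (f : CodedIso M N) : Prop :=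
  ArReducible (graphCode f.toFun) d ∧
  ArReducible (graphCode f.invFun) d ∧
  (∀ (n : ℕ) (X : Set (Fin n → ↥M.carrier)), DefinableIn M X →
      ArEquiv (tupleSetCode X) d →
      ArEquiv (tupleSetCode ((fun v => f.toFun ∘ v) '' X)) d) ∧
  (∀ (n : ℕ) (Y : Set (Fin n → ↥N.carrier)), DefinableIn N Y →
      ArEquiv (tupleSetCode Y) d →
      ArEquiv (tupleSetCode ((fun v => f.invFun ∘ v) '' Y)) d)

/-- `T` is `D`-categorical, where `d` is a representative of the nonzero
arithmetic degree `D`. -/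
def DCategorical (g : GoedelCoding L) (T : L.Theory) (d : Set ℕ) : Prop :=
  ∀ M₀ M₁ M₂ : CodedStructure L,
    ArithDecidable g M₀ → M₀.Models T →
    M₁.Models T → ArithExtendible g T M₁ →
    M₂.Models T → ArithExtendible g T M₂ →
    ElemSub M₀ M₁ → ElemSub M₀ M₂ →
    ArEquiv M₁.carrier d → ArEquiv M₂.carrier d →
    ∃ f : CodedIso M₁ M₂, DPreserving d f ∧
      ∀ (x : ℕ) (hx : x ∈ M₀.carrier) (h₁ : x ∈ M₁.carrier),
        ((f.toFun ⟨x, h₁⟩ : ℕ)) = x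

/-! ## Vaughtian pairs, prime models, strong minimality -/

/-- `T` has a Vaughtian pair. -/
def HasVaughtianPair (T : L.Theory) : Prop :=
  ∃ (N : Type) (SN : L.Structure N),
    ModelsT L T N SN ∧
    ∃ S : @FirstOrder.Language.ElementarySubstructure L N SN,
      ((S.toSubstructure : Set N) ≠ Set.univ ∧
      ∃ (k : ℕ) (φ : L.Formula (Fin 1 ⊕ Fin k)) (a : Fin k → N),
        (∀ i, a i ∈ (S.toSubstructure : Set N)) ∧
        smSet L N SN φ a ⊆ (S.toSubstructure : Set N) ∧
        (smSet L N SN φ a).Infinite)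

/-- A coded model of `T` is prime: it elementarily embeds into every model of `T`. -/
def PrimeModel (L : FirstOrder.Language) (T : L.Theory) (P : CodedStructure L) : Prop :=
  P.Models T ∧ ∀ (N : Type) (SN : L.Structure N), ModelsT L T N SN →
    Nonempty (EEmb L ↥P.carrier P.struc N SN)

/-- `φ(x, p̄)` is strongly minimal over the coded model `M`: its solution set in `M` is
infinite, and in every elementary extension of `M` modelling `T` every definable subset of
its solution set is finite or cofinite in it. -/
def StronglyMinimalOver (T : L.Theory) (M : CodedStructure L) {k : ℕ}
    (φ : L.Formula (Fin 1 ⊕ Fin k)) (p : Fin k → ↥M.carrier) : Prop :=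
  (smSet L ↥M.carrier M.struc φ p).Infinite ∧
  ∀ (N : Type) (SN : L.Structure N), ModelsT L T N SN →
    ∀ j : EEmb L ↥M.carrier M.struc N SN,
      ∀ Y : Set N, Definable1 L N SN Y →
        Y ⊆ smSet L N SN φ (fun i => j.fn (p i)) →
        (Y.Finite ∨ ((smSet L N SN φ (fun i => j.fn (p i))) \ Y).Finite)

/-- `T` is a strongly minimal theory: every model is infinite, and every
parameter-definable subset of any model is finite or cofinite. -/
def StronglyMinimalTheory (L : FirstOrder.Language) (T : L.Theory) : Prop :=
  (∀ (N : Type) (SN : L.Structure N), ModelsT L T N SN → Infinite N) ∧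
  (∀ (N : Type) (SN : L.Structure N), ModelsT L T N SN →
    ∀ Y : Set N, Definable1 L N SN Y → (Y.Finite ∨ (Yᶜ : Set N).Finite))

/-- The structural control clause: an arithmetically decidable prime model together with
a strongly minimal formula over it generating every elementary extension. -/
def GeneratesAll (T : L.Theory) (P : CodedStructure L) {k : ℕ}
    (φ : L.Formula (Fin 1 ⊕ Fin k)) (p : Fin k → ↥P.carrier) : Prop :=
  ∀ (N : Type) (SN : L.Structure N), ModelsT L T N SN →
    ∀ j : EEmb L ↥P.carrier P.struc N SN,
      aclIn L N SN (Set.range j.fn ∪ smSet L N SN φ (fun i => j.fn (p i))) = Set.univ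

/-- Clause (3) of the arithmetic Baldwin–Lachlan theorem. -/
def SMControl (g : GoedelCoding L) (T : L.Theory) : Prop :=
  ∃ (P : CodedStructure L), ArithDecidable g P ∧ PrimeModel L T P ∧
    ∃ (k : ℕ) (φ : L.Formula (Fin 1 ⊕ Fin k)) (p : Fin k → ↥P.carrier),
      StronglyMinimalOver T P φ p ∧ GeneratesAll T P φ p

/-! ## Types and arithmetical stability -/

/-- A formula with a finite parameter tuple from a coded structure, in `n` object
variables. -/
def ParamFormula (L : FirstOrder.Language) (M : CodedStructure L) (n : ℕ) : Type :=
  Σ k : ℕ, L.Formula (Fin n ⊕ Fin k) × (Fin k → ↥M.carrier)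

/-- All parameters of `q` lie in `A`. -/
def paramsIn {M : CodedStructure L} {n : ℕ} (A : Set ℕ) (q : ParamFormula L M n) : Prop :=
  ∀ i, ((q.2.2 i : ℕ)) ∈ A

/-- `p` is consistent with the elementary diagram of `M`: it is realized in some
elementary extension of `M`. -/
def TypeConsistent (M : CodedStructure L) {n : ℕ} (p : Set (ParamFormula L M n)) : Prop :=
  ∃ (N : Type) (SN : L.Structure N) (j : EEmb L ↥M.carrier M.struc N SN) (b : Fin n → N),
    ∀ q ∈ p, letI := SN; q.2.1.Realize (Sum.elim b (fun i => j.fn (q.2.2 i)))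

/-- `p` is a (complete) `n`-type over `A` inside `M`: a maximal set of formulas with
parameters from `A` consistent with the elementary diagram of `M`. -/
def IsNType (M : CodedStructure L) (A : Set ℕ) (n : ℕ)
    (p : Set (ParamFormula L M n)) : Prop :=
  (∀ q ∈ p, paramsIn A q) ∧
  TypeConsistent M p ∧
  ∀ q : ParamFormula L M n, paramsIn A q → q ∉ p → ¬ TypeConsistent M (insert q p)

/-- The code of a formula-with-parameters. -/
def pfCode (g : GoedelCoding L) {M : CodedStructure L} {n : ℕ} (q : ParamFormula L M n) : ℕ :=
  Nat.pair
    (Nat.pair q.1 (formulaCode g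
      (Sum.elim (fun i : Fin n => Nat.pair 0 i.1) (fun j : Fin q.1 => Nat.pair 1 j.1)) q.2.1))
    (tupleCode fun i => ((q.2.2 i : ℕ)))

/-- The set of codes of the formulas of `p`. -/
def typeCode (g : GoedelCoding L) {M : CodedStructure L} {n : ℕ}
    (p : Set (ParamFormula L M n)) : Set ℕ :=
  { c | ∃ q ∈ p, c = pfCode g q }

/-- `p` is realized in the coded elementary extension `N` of `M`. -/
def RealizesType {M N : CodedStructure L} (h : M.carrier ⊆ N.carrier) {n : ℕ}
    (p : Set (ParamFormula L M n)) : Prop :=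
  ∃ b : Fin n → ↥N.carrier, ∀ q ∈ p,
    letI := N.struc
    q.2.1.Realize (Sum.elim b (fun i => (⟨((q.2.2 i : ℕ)), h (q.2.2 i).2⟩ : ↥N.carrier)))

/-- The `(n, i)`-th column of an effective join. -/
def tripleSection (X : Set ℕ) (n i : ℕ) : Set ℕ := { m | Nat.pair n (Nat.pair i m) ∈ X }

/-- `T` is arithmetically stable: over every arithmetically decidable model and every
arithmetical parameter set, the family of arithmetic `n`-types (for all `n ≥ 1`) has a
uniform arithmetical code in which every arithmetic `n`-type appears at least once. -/
def ArithStable (g : GoedelCoding L) (T : L.Theory) : Prop :=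
  ∀ M : CodedStructure L, ArithDecidable g M → M.Models T →
    ∀ A : Set ℕ, A ⊆ M.carrier → IsArithmetical A →
      ∃ X : Set ℕ, IsArithmetical X ∧
        (∀ n, 1 ≤ n → ∀ i : ℕ, ∃ p : Set (ParamFormula L M n),
            IsNType M A n p ∧ IsArithmetical (typeCode g p) ∧
            tripleSection X n i = typeCode g p) ∧
        (∀ n, 1 ≤ n → ∀ p : Set (ParamFormula L M n),
            IsNType M A n p → IsArithmetical (typeCode g p) →
            ∃ i : ℕ, tripleSection X n i = typeCode g p)

/-- The set of elements occurring as a coordinate of a tuple in `X`. -/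
def coordSet {N : Type} {n : ℕ} (X : Set (Fin n → N)) : Set N :=
  { m | ∃ v ∈ X, ∃ i, v i = m }


/-! ## Arithmetical relations and functions -/

/-- A relation on valuations `ℕ → ℕ` definable in arithmetic. -/
def ArithRel (R : (ℕ → ℕ) → Prop) : Prop :=
  letI := arithStructure ∅
  ∃ φ : arithLang.Formula ℕ, ∀ v : ℕ → ℕ, φ.Realize v ↔ R v

/-- A function of valuations `ℕ → ℕ` whose graph is definable in arithmetic. -/
def ArithFun (f : (ℕ → ℕ) → ℕ) : Prop :=
  ArithRel fun v => v 0 = f fun n => v (n + 1)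

namespace ArithRel

variable {R S : (ℕ → ℕ) → Prop}

theorem of_iff (h : ArithRel R) (e : ∀ v, S v ↔ R v) : ArithRel S := by
  obtain ⟨φ, hφ⟩ := h
  exact ⟨φ, fun v => (hφ v).trans (e v).symm⟩

theorem not (h : ArithRel R) : ArithRel fun v => ¬ R v := by
  obtain ⟨φ, hφ⟩ := h
  let := arithStructure ∅
  exact ⟨φ.not, fun v => by rw [Formula.realize_not, hφ]⟩

theorem and (h : ArithRel R) (h' : ArithRel S) : ArithRel fun v => R v ∧ S v := by
  obtain ⟨φ, hφ⟩ := h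
  obtain ⟨ψ, hψ⟩ := h'
  let := arithStructure ∅
  exact ⟨φ ⊓ ψ, fun v => by rw [Formula.realize_inf, hφ, hψ]⟩

theorem imp (h : ArithRel R) (h' : ArithRel S) : ArithRel fun v => R v → S v :=
  (h.and h'.not).not.of_iff fun v => by tauto

theorem or (h : ArithRel R) (h' : ArithRel S) : ArithRel fun v => R v ∨ S v :=
  (h.not.and h'.not).not.of_iff fun v => by tauto

theorem reindex (h : ArithRel R) (r : ℕ → ℕ) : ArithRel fun v => R fun n => v (r n) := by
  obtain ⟨φ, hφ⟩ := h
  let := arithStructure ∅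
  exact ⟨φ.relabel r, fun v => by rw [Formula.realize_relabel, hφ]; rfl⟩

theorem ex {R : (ℕ → ℕ) → ℕ → Prop} (h : ArithRel fun v => R (fun n => v (n + 1)) (v 0)) :
    ArithRel fun v => ∃ x, R v x := by
  obtain ⟨φ, hφ⟩ := h
  let := arithStructure ∅
  refine ⟨(φ.relabel (fun n => Nat.casesOn n (Sum.inr ()) Sum.inl : ℕ → ℕ ⊕ Unit)).iExs Unit,
    fun v => ?_⟩
  rw [Formula.realize_iExs]
  simp only [Formula.realize_relabel, hφ]
  exact ⟨fun ⟨i, hi⟩ => ⟨i (), hi⟩, fun ⟨x, hx⟩ => ⟨fun _ => x, hx⟩⟩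

theorem all {R : (ℕ → ℕ) → ℕ → Prop} (h : ArithRel fun v => R (fun n => v (n + 1)) (v 0)) :
    ArithRel fun v => ∀ x, R v x :=
  (ex (R := fun v x => ¬ R v x) h.not).not.of_iff fun v => by simp

theorem subst₁ {R : ℕ → Prop} {f : (ℕ → ℕ) → ℕ} (h : ArithRel fun v => R (v 0))
    (hf : ArithFun f) : ArithRel fun v => R (f v) :=
  (ex (R := fun v x => x = f v ∧ R x) (hf.and h)).of_iff fun v => by simp

theorem subst₂ {R : ℕ → ℕ → Prop} {f g : (ℕ → ℕ) → ℕ} (h : ArithRel fun v => R (v 0) (v 1))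
    (hf : ArithFun f) (hg : ArithFun g) : ArithRel fun v => R (f v) (g v) := by
  refine (ex (R := fun v x => x = f v ∧ ∃ y, y = g v ∧ R x y) (hf.and (ex ?_))).of_iff
    fun v => by simp
  refine ArithRel.and (ArithRel.reindex hg fun n => Nat.casesOn n 0 fun n => n + 2) ?_
  exact h.reindex fun n => Nat.casesOn n 1 fun _ => 0

theorem subst₃ {R : ℕ → ℕ → ℕ → Prop} {f g k : (ℕ → ℕ) → ℕ}
    (h : ArithRel fun v => R (v 0) (v 1) (v 2))
    (hf : ArithFun f) (hg : ArithFun g) (hk : ArithFun k) :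
    ArithRel fun v => R (f v) (g v) (k v) := by
  refine (ex (R := fun v x => x = f v ∧ ∃ y, y = g v ∧ ∃ z, z = k v ∧ R x y z)
    (hf.and (ex (ArithRel.and ?_ (ex (ArithRel.and ?_ ?_)))))).of_iff fun v => by simp
  · exact ArithRel.reindex hg fun n => Nat.casesOn n 0 fun n => n + 2
  · exact ArithRel.reindex hk fun n => Nat.casesOn n 0 fun n => n + 3
  · exact h.reindex fun n => Nat.casesOn n 2 fun n => Nat.casesOn n 1 fun _ => 0

end ArithRel

namespace ArithFun

variable {f g : (ℕ → ℕ) → ℕ}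

theorem subst₁ {F : ℕ → ℕ} (hF : ArithRel fun v => v 0 = F (v 1)) (hf : ArithFun f) :
    ArithFun fun v => F (f v) :=
  ArithRel.ex (R := fun v x => x = f (fun n => v (n + 1)) ∧ v 0 = F x)
    ((ArithRel.reindex hf fun n => Nat.casesOn n 0 fun n => n + 2).and
      (hF.reindex fun n => Nat.casesOn n 1 fun _ => 0)) |>.of_iff fun v => by simp

theorem subst₂ {F : ℕ → ℕ → ℕ} (hF : ArithRel fun v => v 0 = F (v 1) (v 2)) (hf : ArithFun f)
    (hg : ArithFun g) : ArithFun fun v => F (f v) (g v) := by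
  refine (ArithRel.ex (R := fun v x => x = f (fun n => v (n + 1)) ∧
    ∃ y, y = g (fun n => v (n + 1)) ∧ v 0 = F x y)
    (ArithRel.and ?_ (.ex (ArithRel.and ?_ ?_)))).of_iff fun v => by simp
  · exact ArithRel.reindex hf fun n => Nat.casesOn n 0 fun n => n + 2
  · exact ArithRel.reindex hg fun n => Nat.casesOn n 0 fun n => n + 3
  · exact hF.reindex fun n => Nat.casesOn n 2 fun n => Nat.casesOn n 1 fun _ => 0

end ArithFun

theorem ArithRel.eq_var (i j : ℕ) : ArithRel fun v => v i = v j := by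
  let := arithStructure ∅
  exact ⟨(Term.var i).equal (Term.var j), fun v => by simp [Formula.realize_equal]⟩

theorem ArithFun.var (i : ℕ) : ArithFun fun v => v i := ArithRel.eq_var 0 (i + 1)

theorem ArithRel.eq {f g : (ℕ → ℕ) → ℕ} (hf : ArithFun f) (hg : ArithFun g) :
    ArithRel fun v => f v = g v :=
  (ArithRel.eq_var 0 1).subst₂ hf hg

theorem ArithRel.lt {f g : (ℕ → ℕ) → ℕ} (hf : ArithFun f) (hg : ArithFun g) :
    ArithRel fun v => f v < g v := by
  refine ArithRel.subst₂ (R := (· < ·)) ?_ hf hg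
  let := arithStructure ∅
  refine ⟨Relations.formula₂ (L := arithLang) ArRel.lt (Term.var 0) (Term.var 1), fun v => ?_⟩
  exact Formula.realize_rel₂.trans Iff.rfl

theorem ArithFun.add {f g : (ℕ → ℕ) → ℕ} (hf : ArithFun f) (hg : ArithFun g) :
    ArithFun fun v => f v + g v := by
  refine ArithFun.subst₂ ?_ hf hg
  let := arithStructure ∅
  refine ⟨(Term.var 0).equal (Functions.apply₂ (L := arithLang) ArFunc.add (Term.var 1)
    (Term.var 2)), fun v => ?_⟩
  exact Formula.realize_equal.trans Iff.rfl

theorem ArithFun.mul {f g : (ℕ → ℕ) → ℕ} (hf : ArithFun f) (hg : ArithFun g) :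
    ArithFun fun v => f v * g v := by
  refine ArithFun.subst₂ ?_ hf hg
  let := arithStructure ∅
  refine ⟨(Term.var 0).equal (Functions.apply₂ (L := arithLang) ArFunc.mul (Term.var 1)
    (Term.var 2)), fun v => ?_⟩
  exact Formula.realize_equal.trans Iff.rfl

theorem ArithFun.zero : ArithFun fun _ => 0 := by
  let := arithStructure ∅
  refine ⟨(Term.var 0).equal (Constants.term (L := arithLang) ArFunc.zero), fun v => ?_⟩
  exact Formula.realize_equal.trans Iff.rfl

theorem ArithFun.one : ArithFun fun _ => 1 := by
  let := arithStructure ∅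
  refine ⟨(Term.var 0).equal (Constants.term (L := arithLang) ArFunc.one), fun v => ?_⟩
  exact Formula.realize_equal.trans Iff.rfl

theorem ArithFun.const : ∀ n : ℕ, ArithFun fun _ => n
  | 0 => .zero
  | n + 1 => (ArithFun.const n).add .one

theorem ArithFun.pair {f g : (ℕ → ℕ) → ℕ} (hf : ArithFun f) (hg : ArithFun g) :
    ArithFun fun v => Nat.pair (f v) (g v) := by
  refine ArithFun.subst₂ ?_ hf hg
  refine ArithRel.of_iff (R := fun v => (v 1 < v 2 ∧ v 0 = v 2 * v 2 + v 1) ∨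
    (¬ v 1 < v 2 ∧ v 0 = v 1 * v 1 + v 1 + v 2)) ?_ fun v => ?_
  · exact ((ArithRel.lt (.var 1) (.var 2)).and (.eq (.var 0) (((ArithFun.var 2).mul (.var 2)).add
      (.var 1)))).or ((ArithRel.lt (.var 1) (.var 2)).not.and (.eq (.var 0)
      ((((ArithFun.var 1).mul (.var 1)).add (.var 1)).add (.var 2))))
  · unfold Nat.pair
    split_ifs with h <;> simp [h]

theorem ArithFun.unpair_fst {f : (ℕ → ℕ) → ℕ} (hf : ArithFun f) :
    ArithFun fun v => (f v).unpair.1 := by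
  refine ArithFun.subst₁ (F := fun x => x.unpair.1) ?_ hf
  refine (ArithRel.ex (R := fun v z => v 1 = Nat.pair (v 0) z)
    (.eq (.var 2) (.pair (.var 1) (.var 0)))).of_iff fun v => ?_
  exact ⟨fun h => ⟨(v 1).unpair.2, by rw [h, Nat.pair_unpair]⟩,
    fun ⟨z, hz⟩ => by rw [hz, Nat.unpair_pair]⟩

theorem ArithFun.unpair_snd {f : (ℕ → ℕ) → ℕ} (hf : ArithFun f) :
    ArithFun fun v => (f v).unpair.2 := by
  refine ArithFun.subst₁ (F := fun x => x.unpair.2) ?_ hf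
  refine (ArithRel.ex (R := fun v z => v 1 = Nat.pair z (v 0))
    (.eq (.var 2) (.pair (.var 0) (.var 1)))).of_iff fun v => ?_
  exact ⟨fun h => ⟨(v 1).unpair.1, by rw [h, Nat.pair_unpair]⟩,
    fun ⟨z, hz⟩ => by rw [hz, Nat.unpair_pair]⟩

theorem ArithFun.beta {f g : (ℕ → ℕ) → ℕ} (hf : ArithFun f) (hg : ArithFun g) :
    ArithFun fun v => Nat.beta (f v) (g v) := by
  refine ArithFun.subst₂ ?_ hf hg
  refine ArithRel.of_iff (R := fun v => v 0 < (v 2 + 1) * (v 1).unpair.2 + 1 ∧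
    ∃ q, (v 1).unpair.1 = ((v 2 + 1) * (v 1).unpair.2 + 1) * q + v 0) ?_ fun v => ?_
  · refine (ArithRel.lt (.var 0) ?_).and (.ex (.eq (.unpair_fst (.var 2))
      (.add (.mul ?_ (.var 0)) (.var 1))))
    · exact .add (.mul (.add (.var 2) .one) (.unpair_snd (.var 1))) .one
    · exact .add (.mul (.add (.var 3) .one) (.unpair_snd (.var 2))) .one
  · rw [Nat.beta]
    refine ⟨fun h => ?_, fun ⟨h, q, hq⟩ => ?_⟩
    · rw [h]
      exact ⟨Nat.mod_lt _ (Nat.succ_pos _), _, (Nat.div_add_mod _ _).symm⟩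
    · rw [hq, Nat.mul_add_mod, Nat.mod_eq_of_lt h]

/-- Functions defined by iterating an arithmetical relation have arithmetical graphs. -/
theorem ArithRel.recursion {F : ℕ → ℕ → ℕ} {G : ℕ → ℕ → ℕ → ℕ → Prop}
    (h₀ : ArithRel fun v => v 0 = F (v 1) 0)
    (hG : ArithRel fun v => G (v 0) (v 1) (v 2) (v 3))
    (hF : ∀ z i y, G z i (F z i) y ↔ y = F z (i + 1)) :
    ArithRel fun v => v 0 = F (v 1) (v 2) := by
  refine ArithRel.of_iff (R := fun v => ∃ b, Nat.beta b 0 = F (v 1) 0 ∧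
    (∀ i, i < v 2 → G (v 1) i (Nat.beta b i) (Nat.beta b (i + 1))) ∧
    v 0 = Nat.beta b (v 2)) ?_ fun v => ?_
  · refine .ex (.and (.eq (.beta (.var 0) .zero) (.subst₁ (F := fun z => F z 0) h₀ (.var 2)))
      (.and (.all (.imp
      (.lt (.var 0) (.var 4)) ?_)) (.eq (.var 1) (.beta (.var 0) (.var 3)))))
    refine ArithRel.of_iff (R := fun v => ∃ x, x = Nat.beta (v 1) (v 0) ∧
      ∃ y, y = Nat.beta (v 1) (v 0 + 1) ∧ G (v 3) (v 0) x y) ?_ fun v => by simp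
    refine .ex (.and (.eq (.var 0) (.beta (.var 2) (.var 1))) (.ex (.and
      (.eq (.var 0) (.beta (.var 3) (.add (.var 2) .one))) ?_)))
    exact hG.reindex fun n => Nat.casesOn n 5 fun n => Nat.casesOn n 2 fun n =>
      Nat.casesOn n 1 fun _ => 0
  · constructor
    · intro h
      let l := List.ofFn fun i : Fin (v 2 + 1) => F (v 1) i
      have hl : l.length = v 2 + 1 := List.length_ofFn
      have key : ∀ i, i ≤ v 2 → Nat.beta (Nat.unbeta l) i = F (v 1) i := fun i hi => by
        have := Nat.beta_unbeta_coe l ⟨i, by omega⟩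
        rw [this]
        exact List.getElem_ofFn _
      refine ⟨Nat.unbeta l, key 0 (Nat.zero_le _), fun i hi => ?_, by rw [key _ le_rfl, h]⟩
      rw [key i hi.le, key (i + 1) hi, hF]
    · rintro ⟨b, hb0, hb, h⟩
      have key : ∀ i, i ≤ v 2 → Nat.beta b i = F (v 1) i := by
        intro i
        induction i with
        | zero => exact fun _ => hb0
        | succ i ih =>
          intro hi
          have := hb i hi
          rwa [ih (Nat.le_of_succ_le hi), hF] at this
      rw [h, key _ le_rfl]

theorem ArithRel.of_primrec {f : ℕ → ℕ} (hf : Nat.Primrec f) :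
    ArithRel fun v => v 0 = f (v 1) := by
  induction hf with
  | zero => exact .eq (.var 0) .zero
  | succ => exact .eq (.var 0) (.add (.var 1) .one)
  | left => exact .eq (.var 0) (.unpair_fst (.var 1))
  | right => exact .eq (.var 0) (.unpair_snd (.var 1))
  | pair _ _ ihf ihg => exact .eq (.var 0) (.pair (.subst₁ ihf (.var 1)) (.subst₁ ihg (.var 1)))
  | comp _ _ ihf ihg => exact .eq (.var 0) (.subst₁ ihf (.subst₁ ihg (.var 1)))
  | @prec f g _ _ ihf ihg =>
    let F : ℕ → ℕ → ℕ := fun z n => Nat.rec (motive := fun _ => ℕ) (f z)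
        (fun y IH => g (Nat.pair z (Nat.pair y IH))) n
    have h : ArithRel fun v => v 0 = F (v 1) (v 2) := by
      refine ArithRel.recursion (F := F)
        (G := fun z i x y => y = g (Nat.pair z (Nat.pair i x))) ihf ?_
        fun z i y => Iff.rfl
      exact .eq (.var 3) (.subst₁ ihg (.pair (.var 0) (.pair (.var 1) (.var 2))))
    exact ArithRel.eq (.var 0) (ArithFun.subst₂ (F := F) h (.unpair_fst (.var 1))
      (.unpair_snd (.var 1)))

theorem isArithmetical_iff {X : Set ℕ} : IsArithmetical X ↔ ArithRel fun v => v 0 ∈ X := by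
  let := arithStructure ∅
  constructor
  · rintro ⟨φ, rfl⟩
    refine ⟨φ.relabel fun _ => 0, fun v => ?_⟩
    rw [Formula.realize_relabel]
    rfl
  · rintro ⟨φ, hφ⟩
    refine ⟨φ.relabel fun _ => 0, Set.ext fun n => ?_⟩
    rw [Set.mem_ofPred_eq, Formula.realize_relabel, hφ]
    rfl


/-! ## Recoding formulas with parameters -/

/-- Apply `f` to the second component of a coded pair whose first component is `0`. -/
def mapTag (f : ℕ → ℕ) (x : ℕ) : ℕ :=
  if x.unpair.1 = 0 then Nat.pair 0 (f x.unpair.2) else x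

@[simp]
theorem mapTag_zero (f : ℕ → ℕ) (x : ℕ) : mapTag f (Nat.pair 0 x) = Nat.pair 0 (f x) := by
  simp [mapTag]

@[simp]
theorem mapTag_succ (f : ℕ → ℕ) (n x : ℕ) :
    mapTag f (Nat.pair (n + 1) x) = Nat.pair (n + 1) x := by
  simp [mapTag]

@[simp]
theorem mapTag_one (f : ℕ → ℕ) (x : ℕ) : mapTag f (Nat.pair 1 x) = Nat.pair 1 x :=
  mapTag_succ f 0 x

@[simp]
theorem mapTag_two (f : ℕ → ℕ) (x : ℕ) : mapTag f (Nat.pair 2 x) = Nat.pair 2 x :=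
  mapTag_succ f 1 x

theorem primrec_mapTag {f : ℕ → ℕ} (hf : Primrec f) : Primrec (mapTag f) :=
  Primrec.ite (PrimrecRel.comp Primrec.eq (Primrec.fst.comp Primrec.unpair) (Primrec.const 0))
    (Primrec₂.natPair.comp (Primrec.const 0) (hf.comp (Primrec.snd.comp Primrec.unpair)))
    Primrec.id

/-- Apply `f` to all entries of a coded list. -/
def mapCode (f : ℕ → ℕ) (c : ℕ) : ℕ :=
  listCode (((Encodable.decode c : Option (List ℕ)).getD []).map f)

@[simp]
theorem mapCode_listCode (f : ℕ → ℕ) (l : List ℕ) :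
    mapCode f (listCode l) = listCode (l.map f) := by
  simp [mapCode, listCode]

theorem primrec_mapCode {f : ℕ → ℕ} (hf : Primrec f) : Primrec (mapCode f) :=
  Primrec.encode.comp (Primrec.list_map (Primrec.option_getD.comp Primrec.decode
    (Primrec.const [])) (hf.comp Primrec.snd).to₂)

/-- Change the codes of the free variables in the code of a formula. -/
def recodeFormula (τ : ℕ → ℕ) : ℕ → ℕ :=
  mapCode (mapTag fun y => Nat.pair y.unpair.1 (mapCode (mapTag (mapTag τ)) y.unpair.2))

theorem primrec_recodeFormula {τ : ℕ → ℕ} (hτ : Primrec τ) : Primrec (recodeFormula τ) :=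
  primrec_mapCode (primrec_mapTag (Primrec₂.natPair.comp (Primrec.fst.comp Primrec.unpair)
    ((primrec_mapCode (primrec_mapTag (primrec_mapTag hτ))).comp
      (Primrec.snd.comp Primrec.unpair))))

theorem listEncode_term_relabel {α β : Type} (f : α → β) (t : L.Term α) :
    (t.relabel f).listEncode = t.listEncode.map (Sum.map f id) := by
  induction t with
  | var => rfl
  | func F ts ih =>
    simp only [Term.relabel, Term.listEncode, List.map_cons, Sum.map_inr, id_eq,
      List.map_flatMap, ih]

theorem listEncode_relabelEquiv {α β : Type} (e : α ≃ β) {n : ℕ} (φ : L.BoundedFormula α n) :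
    (BoundedFormula.relabelEquiv e φ).listEncode =
      φ.listEncode.map (Sum.map (fun p => ⟨p.1, p.2.relabel (Sum.map e id)⟩) id) := by
  unfold BoundedFormula.relabelEquiv
  rw [BoundedFormula.mapTermRelEquiv_apply]
  induction φ with
  | falsum => rfl
  | equal => rfl
  | rel =>
    simp only [BoundedFormula.mapTermRel, BoundedFormula.listEncode, List.map_append,
      List.map_cons, List.map_map, List.map_nil]
    rfl
  | imp _ _ ih₁ ih₂ =>
    simp only [BoundedFormula.mapTermRel, BoundedFormula.listEncode, ih₁, ih₂, List.map_append,
      List.map_cons, List.cons_append]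
    rfl
  | all _ ih =>
    simp only [BoundedFormula.mapTermRel, BoundedFormula.listEncode, id_eq, ih, List.map_cons]
    rfl

theorem formulaCode_relabelEquiv (g : GoedelCoding L) {α β : Type} {encα : α → ℕ} {encβ : β → ℕ}
    (e : α ≃ β) {τ : ℕ → ℕ} (hτ : ∀ a, encβ (e a) = τ (encα a)) {n : ℕ}
    (φ : L.BoundedFormula α n) :
    formulaCode g encβ (BoundedFormula.relabelEquiv e φ) =
      recodeFormula τ (formulaCode g encα φ) := by
  unfold formulaCode recodeFormula
  rw [mapCode_listCode, listEncode_relabelEquiv, List.map_map, List.map_map]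
  congr 2
  funext p
  rcases p with ⟨n, t⟩ | ⟨n, R⟩ | m
  · simp only [Function.comp_apply, Sum.map_inl, Sum.elim_inl, mapTag_zero, Nat.unpair_pair]
    congr 2
    unfold termCode
    rw [mapCode_listCode, listEncode_term_relabel, List.map_map, List.map_map]
    congr 2
    funext p
    rcases p with (a | i) | ⟨n, F⟩ <;> simp [hτ]
  · simp
  · simp

theorem listCode_injective : Function.Injective listCode := Encodable.encode_injective

theorem tupleCode_injective {n : ℕ} : Function.Injective (tupleCode (n := n)) :=
  listCode_injective.comp List.ofFn_injective

theorem termCode_injective (g : GoedelCoding L) {α : Type} {enc : α → ℕ}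
    (h : Function.Injective enc) : Function.Injective (termCode g enc) := by
  refine listCode_injective.comp ((List.map_injective_iff.2 ?_).comp Term.listEncode_injective)
  rintro (a | ⟨n, F⟩) (b | ⟨m, F'⟩) hab
  · simp only [Sum.elim_inl, Nat.pair_eq_pair, true_and] at hab
    rw [h hab]
  · simp at hab
  · simp at hab
  · simp only [Sum.elim_inr, Nat.pair_eq_pair, true_and] at hab
    obtain ⟨rfl, hab⟩ := hab
    rw [g.encFun_inj _ hab]

theorem formulaCode_injective (g : GoedelCoding L) {α : Type} {enc : α → ℕ}
    (h : Function.Injective enc) {n : ℕ} :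
    Function.Injective (formulaCode g enc : L.BoundedFormula α n → ℕ) := by
  have hl : Function.Injective fun φ : L.BoundedFormula α n => φ.listEncode := fun φ ψ hφψ => by
    have := @BoundedFormula.listEncode_sigma_injective L α ⟨n, φ⟩ ⟨n, ψ⟩ hφψ
    simpa using this
  refine listCode_injective.comp ((List.map_injective_iff.2 ?_).comp hl)
  rintro (⟨n, t⟩ | ⟨n, R⟩ | n) (⟨m, s⟩ | ⟨m, S⟩ | m) hab
  · simp only [Sum.elim_inl, Nat.pair_eq_pair, true_and] at hab
    obtain ⟨rfl, hab⟩ := hab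
    have := termCode_injective g ?_ hab
    · rw [this]
    · rintro (a | i) (b | j) hij <;> simp [Fin.ext_iff] at hij ⊢
      · exact h hij
      · exact hij
  · simp at hab
  · simp at hab
  · simp at hab
  · simp only [Sum.elim_inr, Sum.elim_inl, Nat.pair_eq_pair, true_and] at hab
    obtain ⟨rfl, hab⟩ := hab
    rw [g.encRel_inj _ hab]
  · simp at hab
  · simp at hab
  · simp at hab
  · simp only [Sum.elim_inr, Nat.pair_eq_pair, true_and] at hab
    rw [hab]

theorem pfCode_injective (g : GoedelCoding L) (M : CodedStructure L) (n : ℕ) :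
    Function.Injective (pfCode g : ParamFormula L M n → ℕ) := by
  rintro ⟨k, φ, a⟩ ⟨k', φ', a'⟩ h
  simp only [pfCode, Nat.pair_eq_pair] at h
  obtain ⟨⟨rfl, h⟩, h'⟩ := h
  have h₁ := formulaCode_injective g (enc := Sum.elim (fun i : Fin n => Nat.pair 0 i.1)
    (fun j : Fin k => Nat.pair 1 j.1)) (by
      rintro (i | i) (j | j) hij <;> simp [Fin.ext_iff] at hij ⊢ <;> exact hij) h
  have h₂ : a = a' := funext fun i => Subtype.ext (congrFun (tupleCode_injective h') i)
  rw [h₁, h₂]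

/-- The formula with parameters `q` holds at `x`. -/
def ParamFormula.Holds {M : CodedStructure L} (q : ParamFormula L M 1) (x : ↥M.carrier) : Prop :=
  letI := M.struc
  q.2.1.Realize (Sum.elim (fun _ => x) q.2.2)

/-- `x` is an element satisfying the formula with parameters coded by `c`. -/
def CodeSat (g : GoedelCoding L) (M : CodedStructure L) (x c : ℕ) : Prop :=
  ∃ (hx : x ∈ M.carrier) (q : ParamFormula L M 1), c = pfCode g q ∧ q.Holds ⟨x, hx⟩

theorem codeSat_pfCode {g : GoedelCoding L} {M : CodedStructure L} {x : ↥M.carrier}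
    {q : ParamFormula L M 1} : CodeSat g M x (pfCode g q) ↔ q.Holds x := by
  constructor
  · rintro ⟨_, q', h, hq⟩
    rwa [pfCode_injective g M 1 h]
  · exact fun h => ⟨x.2, q, rfl, h⟩

/-- Split off the first variable of a tuple. -/
def finSuccSplit (k : ℕ) : Fin (k + 1) ≃ Fin 1 ⊕ Fin k where
  toFun := Fin.cases (Sum.inl 0) Sum.inr
  invFun := Sum.elim (fun _ => 0) Fin.succ
  left_inv i := by cases i using Fin.cases <;> rfl
  right_inv i := by
    rcases i with i | i
    · rw [Subsingleton.elim i 0]; rfl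
    · rfl

/-- The action of `finSuccSplit` on codes of variables. -/
def splitCode (n : ℕ) : ℕ := if n = 0 then Nat.pair 0 0 else Nat.pair 1 (n - 1)

theorem primrec_splitCode : Primrec splitCode :=
  Primrec.ite (PrimrecRel.comp Primrec.eq Primrec.id (Primrec.const 0)) (Primrec.const _)
    (Primrec₂.natPair.comp (Primrec.const 1) (Primrec.nat_sub.comp Primrec.id (Primrec.const 1)))

theorem codeSat_iff (g : GoedelCoding L) (M : CodedStructure L) (x c : ℕ) :
    CodeSat g M x c ↔ ∃ k f t, Nat.pair (Nat.pair (k + 1) f) (Nat.pair x t + 1) ∈ elemDiagram g M ∧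
      c = Nat.pair (Nat.pair k (recodeFormula splitCode f)) t := by
  have hτ : ∀ (k : ℕ) (i : Fin (k + 1)), Sum.elim (fun i : Fin 1 => Nat.pair 0 i.1)
      (fun j : Fin k => Nat.pair 1 j.1) (finSuccSplit k i) = splitCode i.1 := by
    intro k i
    cases i using Fin.cases <;> simp [finSuccSplit, splitCode]
  let := M.struc
  constructor
  · rintro ⟨hx, ⟨k, φ, a⟩, rfl, h⟩
    obtain ⟨φ', rfl⟩ := (BoundedFormula.relabelEquiv (finSuccSplit k)).surjective φ
    refine ⟨k, formulaCode g Fin.val φ', tupleCode fun i => (a i : ℕ), ?_, ?_⟩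
    · refine ⟨k + 1, φ', Fin.cons ⟨x, hx⟩ a, ?_, ?_⟩
      · have hc : tupleCode (fun i => ((Fin.cons ⟨x, hx⟩ a : Fin (k + 1) → ↥M.carrier) i : ℕ)) =
            Nat.pair x (tupleCode fun i => (a i : ℕ)) + 1 := by
          unfold tupleCode
          rw [List.ofFn_succ]
          rfl
        rw [hc]
      · have h' := BoundedFormula.realize_relabelEquiv.1 h
        refine (iff_of_eq ?_).1 h'
        unfold Formula.Realize
        congr 1
        funext i
        cases i using Fin.cases <;> rfl
    · rw [← formulaCode_relabelEquiv g _ (hτ k)]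
      rfl
  · rintro ⟨k, f, t, ⟨k', φ', a', h, hr⟩, rfl⟩
    rw [Nat.pair_eq_pair, Nat.pair_eq_pair] at h
    obtain ⟨⟨rfl, rfl⟩, h⟩ := h
    have h' : Nat.pair x t + 1 =
        Nat.pair (a' 0) (tupleCode fun i : Fin k => (a' i.succ : ℕ)) + 1 := by
      rw [h, tupleCode, List.ofFn_succ]
      rfl
    rw [add_left_inj, Nat.pair_eq_pair] at h'
    obtain ⟨rfl, rfl⟩ := h'
    refine ⟨(a' 0).2, ⟨k, BoundedFormula.relabelEquiv (finSuccSplit k) φ', fun i => a' i.succ⟩,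
      ?_, ?_⟩
    · rw [← formulaCode_relabelEquiv g _ (hτ k)]
      rfl
    · refine BoundedFormula.realize_relabelEquiv.2 ((iff_of_eq ?_).1 hr)
      unfold Formula.Realize
      congr 1
      funext i
      cases i using Fin.cases <;> rfl

theorem arithRel_codeSat {g : GoedelCoding L} {M : CodedStructure L} (hM : ArithDecidable g M) :
    ArithRel fun v => CodeSat g M (v 0) (v 1) := by
  refine ArithRel.of_iff ?_ fun v => codeSat_iff g M (v 0) (v 1)
  refine .ex (.ex (.ex (.and ?_ ?_)))
  · exact .subst₁ (R := (· ∈ elemDiagram g M)) (isArithmetical_iff.1 hM)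
      (.pair (.pair (.add (.var 2) .one) (.var 1)) (.add (.pair (.var 3) (.var 0)) .one))
  · exact .eq (.var 4) (.pair (.pair (.var 2) (.subst₁ (.of_primrec
      (Primrec.nat_iff.1 (primrec_recodeFormula primrec_splitCode))) (.var 1))) (.var 0))


/-! ## Ultrapowers -/

/-- The ultrapower of `M` over a nonprincipal ultrafilter on `ℕ`. -/
abbrev Ultrapower (M : Type) : Type :=
  ((Filter.hyperfilter ℕ : Ultrafilter ℕ) : Filter ℕ).Product fun _ => M

namespace Ultrapower

variable {M N : Type}

/-- The class of a sequence in the ultrapower. -/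
noncomputable def mk (f : ℕ → M) : Ultrapower M := (f : Filter.Product _ _)

theorem exists_rep (x : Ultrapower M) : ∃ f : ℕ → M, mk f = x := Quotient.exists_rep x

theorem mk_eq_mk {f f' : ℕ → M} :
    mk f = mk f' ↔ ∀ᶠ n in (Filter.hyperfilter ℕ : Filter ℕ), f n = f' n :=
  Quotient.eq''

theorem realize_mk [L.Structure M] [Nonempty M] {β : Type*} (φ : L.Formula β) (x : β → ℕ → M) :
    (φ.Realize fun i => mk (x i)) ↔
      ∀ᶠ n in (Filter.hyperfilter ℕ : Filter ℕ), φ.Realize fun i => x i n :=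
  Ultraproduct.realize_formula_cast φ x

/-- The diagonal embedding into the ultrapower. -/
noncomputable def diag (L : FirstOrder.Language) (M : Type) [L.Structure M] [Nonempty M] :
    M ↪ₑ[L] Ultrapower M where
  toFun m := mk fun _ => m
  map_formula' _ φ x := (realize_mk φ fun i _ => x i).trans Filter.eventually_const

/-- The map of ultrapowers induced by an elementary embedding. -/
noncomputable def map [L.Structure M] [Nonempty M] [L.Structure N] [Nonempty N] (j : M ↪ₑ[L] N) :
    Ultrapower M ↪ₑ[L] Ultrapower N where
  toFun := Quotient.map' (fun f n => j (f n)) fun _ _ h =>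
    Filter.Eventually.mono h fun _ h => congrArg j h
  map_formula' _ φ x := by
    choose f hf using fun i => exists_rep (x i)
    obtain rfl : (fun i => mk (f i)) = x := funext hf
    refine (realize_mk φ fun i n => j (f i n)).trans (Iff.trans ?_ (realize_mk φ f).symm)
    exact Filter.eventually_congr (Filter.Eventually.of_forall fun n => j.map_formula φ _)

end Ultrapower

/-- The range of an elementary embedding. -/
def elementaryRange {M N : Type} [L.Structure M] [L.Structure N] (j : M ↪ₑ[L] N) :
    L.ElementarySubstructure N where
  toSubstructure := j.toHom.range
  isElementary' n φ x := by
    choose y hy using fun i => (x i).2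
    have hx : x = fun i => j.toEmbedding.equivRange (y i) := by
      funext i
      exact Subtype.ext (hy i).symm
    have h₁ : φ.Realize x ↔ φ.Realize y := by
      rw [hx]
      exact StrongHomClass.realize_formula j.toEmbedding.equivRange φ
    rw [h₁, ← j.map_formula φ y, hx]
    rfl

theorem mem_elementaryRange {M N : Type} [L.Structure M] [L.Structure N] {j : M ↪ₑ[L] N} {x : N} :
    x ∈ ((elementaryRange j).toSubstructure : Set N) ↔ ∃ y, j y = x := by
  exact Iff.rfl

theorem modelsT_of_elementaryEmbedding {T : L.Theory} {M N : Type} [SM : L.Structure M]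
    [SN : L.Structure N] (j : M ↪ₑ[L] N) (hM : ModelsT L T M SM) : ModelsT L T N SN :=
  fun φ hφ => (j.map_sentence φ).1 (hM φ hφ)

/-! ## Uniform finiteness -/

/-- In a model of a theory without Vaughtian pairs, the finite members of a definable family
have bounded size. -/
theorem exists_ncard_lt_of_not_hasVaughtianPair {T : L.Theory} (hT : ¬ HasVaughtianPair T)
    {M : Type} [SM : L.Structure M] [Infinite M] (hM : ModelsT L T M SM) {k : ℕ}
    (χ : L.Formula (Fin 1 ⊕ Fin k)) :
    ∃ n, ∀ b : Fin k → M, (smSet L M SM χ b).Finite → (smSet L M SM χ b).ncard < n := by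
  by_contra! h
  choose b hb hcard using h
  let j := Ultrapower.diag L M
  have hreal : ∀ (f : ℕ → Ultrapower M),
      Ultrapower.mk f ∈ smSet L (Ultrapower (Ultrapower M)) inferInstance χ
        (fun i => Ultrapower.mk fun n => j (b n i)) ↔
      ∀ᶠ n in (Filter.hyperfilter ℕ : Filter ℕ),
        f n ∈ smSet L (Ultrapower M) inferInstance χ (fun i => j (b n i)) := by
    intro f
    have := Ultrapower.realize_mk χ (Sum.elim (fun _ => f) fun i n => j (b n i))
    refine Iff.trans (iff_of_eq ?_) (this.trans (iff_of_eq ?_))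
    · show χ.Realize _ = _
      congr 1
      funext i
      rcases i with i | i <;> rfl
    · congr 1
      funext n
      show _ = χ.Realize _
      congr 1
      funext i
      rcases i with i | i <;> rfl
  have hfin : ∀ (n : ℕ) (y : Ultrapower M),
      y ∈ smSet L (Ultrapower M) inferInstance χ (fun i => j (b n i)) → ∃ m, j m = y := by
    intro n y hy
    obtain ⟨f, rfl⟩ := Ultrapower.exists_rep y
    have h₁ : ∀ᶠ i in (Filter.hyperfilter ℕ : Filter ℕ), f i ∈ smSet L M SM χ (b n) := by
      refine (iff_of_eq ?_).1 ((Ultrapower.realize_mk χ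
        (Sum.elim (fun _ => f) fun i _ => b n i)).1 ((iff_of_eq ?_).1 hy))
      · congr 1
        funext n
        show _ = χ.Realize _
        congr 1
        funext i
        rcases i with i | i <;> rfl
      · show χ.Realize _ = _
        congr 1
        funext i
        rcases i with i | i <;> rfl
    have h₂ : ∃ m ∈ smSet L M SM χ (b n),
        ∀ᶠ i in (Filter.hyperfilter ℕ : Filter ℕ), f i = m :=
      (Ultrafilter.eventually_exists_mem_iff (hb n) (P := fun m i => f i = m)).1
        (h₁.mono fun i hi => ⟨_, hi, rfl⟩)
    obtain ⟨m, -, hm⟩ := h₂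
    exact ⟨m, Ultrapower.mk_eq_mk.2 (hm.mono fun _ h => h.symm)⟩
  have hproper : ∃ y : Ultrapower M, ∀ m, j m ≠ y := by
    refine ⟨Ultrapower.mk (Infinite.natEmbedding M), fun m hm => ?_⟩
    have h₁ := Ultrapower.mk_eq_mk.1 hm
    have h₂ : {n | m = Infinite.natEmbedding M n}.Finite :=
      Set.Subsingleton.finite fun a ha b hb =>
        (Infinite.natEmbedding M).injective (ha.symm.trans hb)
    exact Filter.notMem_hyperfilter_of_finite h₂ h₁
  refine hT ⟨Ultrapower (Ultrapower M), inferInstance, modelsT_of_elementaryEmbedding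
    ((Ultrapower.diag L (Ultrapower M)).comp j) hM, elementaryRange (Ultrapower.map j), ?_, k, χ,
    fun i => Ultrapower.mk fun n => j (b n i), ?_, ?_, ?_⟩
  · intro huniv
    obtain ⟨y, hy⟩ := hproper
    obtain ⟨z, hz⟩ := mem_elementaryRange.1 (huniv ▸ Set.mem_univ (Ultrapower.mk fun _ => y))
    obtain ⟨f, rfl⟩ := Ultrapower.exists_rep z
    obtain ⟨n, hn⟩ := (Ultrapower.mk_eq_mk.1 hz).exists
    exact hy _ hn
  · exact fun i => mem_elementaryRange.2 ⟨Ultrapower.mk fun n => b n i, rfl⟩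
  · intro y hy
    obtain ⟨f, rfl⟩ := Ultrapower.exists_rep y
    have hf := ((hreal f).1 hy).mono fun n hn => hfin n _ hn
    have : Nonempty M := inferInstance
    let f' : ℕ → M := fun n => Classical.epsilon fun m => j m = f n
    refine mem_elementaryRange.2 ⟨Ultrapower.mk f', Ultrapower.mk_eq_mk.2 (hf.mono fun n hn => ?_)⟩
    exact Classical.epsilon_spec hn
  · have hex : ∀ n, ∃ h : ℕ → M, ∀ i < n, h i ∈ smSet L M SM χ (b n) ∧
        ∀ i' < n, h i = h i' → i = i' := by
      intro n
      have : Nonempty (Fin n ↪ ↥(hb n).toFinset) := by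
        rw [Function.Embedding.nonempty_iff_card_le]
        simpa [Set.ncard_eq_toFinset_card _ (hb n)] using hcard n
      obtain ⟨e⟩ := this
      refine ⟨fun i => if hi : i < n then e ⟨i, hi⟩ else Classical.arbitrary M,
        fun i hi => ⟨?_, ?_⟩⟩
      · have := (e ⟨i, hi⟩).2
        rw [Set.Finite.mem_toFinset] at this
        simpa [hi] using this
      · intro i' hi' h
        simp only [hi, hi', dif_pos] at h
        simpa using e.injective (Subtype.ext h)
    choose h hh using hex
    have hlt : ∀ i, ∀ᶠ n in (Filter.hyperfilter ℕ : Filter ℕ), i < n := fun i =>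
      Filter.Eventually.filter_mono Nat.hyperfilter_le_atTop (Filter.eventually_gt_atTop i)
    refine Set.infinite_of_injective_forall_mem
      (f := fun i => (Ultrapower.mk fun n => j (h n i) : Ultrapower (Ultrapower M))) ?_ ?_
    · intro i i' hii
      obtain ⟨n, ⟨hn, hi⟩, hi'⟩ := (((Ultrapower.mk_eq_mk.1 hii).and (hlt i)).and (hlt i')).exists
      exact (hh n i hi).2 i' hi' (j.injective hn)
    · refine fun i => (hreal _).2 ((hlt i).mono fun n hn => ?_)
      refine (iff_of_eq ?_).1 ((j.map_formula χ _).2 (hh n i hn).1)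
      show _ = χ.Realize _
      congr 1
      funext i
      rcases i with i | i <;> rfl

/-! ## Minimal formulas -/

/-- Arithmetical dependent choice. -/
theorem ArithRel.exists_sequence {S : ℕ → ℕ → ℕ → Prop}
    (hS : ArithRel fun v => S (v 0) (v 1) (v 2)) {I : ℕ → Prop} {c : ℕ} (hc : I c)
    (hex : ∀ s c, I c → ∃ c', S s c c') (hI : ∀ s c c', S s c c' → I c') :
    ∃ F : ℕ → ℕ, (ArithRel fun v => v 0 = F (v 1)) ∧ ∀ s, S s (F s) (F (s + 1)) := by
  classical
  let F' : ℕ → { c // I c } := fun n => Nat.rec ⟨c, hc⟩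
    (fun s d => ⟨Nat.find (hex s d.1 d.2), hI _ _ _ (Nat.find_spec (hex s d.1 d.2))⟩) n
  have hF' : ∀ s, (F' (s + 1)).1 = Nat.find (hex s (F' s).1 (F' s).2) := fun s => rfl
  refine ⟨fun n => (F' n).1, ?_, fun s => ?_⟩
  · have := ArithRel.recursion (F := fun _ i => (F' i).1)
      (G := fun _ s c y => S s c y ∧ ∀ w, w < y → ¬ S s c w)
      (.eq (.var 0) (.const c))
      (.and (.subst₃ hS (.var 1) (.var 2) (.var 3))
        (.all (.imp (.lt (.var 0) (.var 4)) (.not (.subst₃ hS (.var 2) (.var 3) (.var 0))))))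
      fun _ i y => by rw [hF', eq_comm, Nat.find_eq_iff]
    exact this.reindex fun n => Nat.casesOn n 0 fun _ => 1
  · show S s _ (F' (s + 1)).1
    rw [hF']
    exact Nat.find_spec (hex s (F' s).1 (F' s).2)

namespace ParamFormula

variable {M : CodedStructure L}

theorem exists_holds_iff_realize {β : Type} [Finite β] (ψ : L.Formula (Fin 1 ⊕ β))
    (b : β → ↥M.carrier) :
    ∃ q : ParamFormula L M 1, ∀ x, q.Holds x ↔
      (letI := M.struc; ψ.Realize (Sum.elim (fun _ => x) b)) := by
  let := M.struc
  obtain ⟨m, ⟨e⟩⟩ := Finite.exists_equiv_fin β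
  refine ⟨⟨m, ψ.relabel (Sum.map id e), b ∘ e.symm⟩, fun x => ?_⟩
  refine Formula.realize_relabel.trans (iff_of_eq ?_)
  congr 1
  funext i
  rcases i with i | i <;> simp

theorem exists_holds_iff_true : ∃ q : ParamFormula L M 1, ∀ x, q.Holds x := by
  let := M.struc
  obtain ⟨q, hq⟩ := exists_holds_iff_realize (M := M) (β := Empty) ⊤ Empty.elim
  exact ⟨q, fun x => (hq x).2 (by simp)⟩

theorem exists_holds_iff_not (q : ParamFormula L M 1) :
    ∃ r : ParamFormula L M 1, ∀ x, r.Holds x ↔ ¬ q.Holds x := by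
  let := M.struc
  exact ⟨⟨q.1, q.2.1.not, q.2.2⟩, fun x => Formula.realize_not⟩

theorem exists_holds_iff_and (q r : ParamFormula L M 1) :
    ∃ s : ParamFormula L M 1, ∀ x, s.Holds x ↔ q.Holds x ∧ r.Holds x := by
  let := M.struc
  obtain ⟨s, hs⟩ := exists_holds_iff_realize (M := M) (β := Fin q.1 ⊕ Fin r.1)
    (q.2.1.relabel (Sum.map id Sum.inl) ⊓ r.2.1.relabel (Sum.map id Sum.inr))
    (Sum.elim q.2.2 r.2.2)
  refine ⟨s, fun x => (hs x).trans ?_⟩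
  rw [Formula.realize_inf, Formula.realize_relabel, Formula.realize_relabel]
  refine iff_of_eq (congrArg₂ _ ?_ ?_)
  all_goals
    show _ = Formula.Realize _ _
    congr 1
    funext i
    rcases i with i | i <;> rfl

end ParamFormula

/-- The formulas that hold along an ultrafilter at a sequence form a complete type. -/
theorem isNType_eventually_holds (M : CodedStructure L) (x : ℕ → ↥M.carrier) :
    IsNType M M.carrier 1
      { q | ∀ᶠ n in (Filter.hyperfilter ℕ : Filter ℕ), q.Holds (x n) } := by
  let := M.struc
  have : Nonempty ↥M.carrier := ⟨x 0⟩
  refine ⟨fun q _ i => (q.2.2 i).2, ?_, ?_⟩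
  · refine ⟨Ultrapower ↥M.carrier, inferInstance, Ultrapower.diag L ↥M.carrier,
      fun _ => Ultrapower.mk x, fun q hq => ?_⟩
    refine (iff_of_eq ?_).1 ((Ultrapower.realize_mk q.2.1
      (Sum.elim (fun _ => x) fun i _ => q.2.2 i)).2 (Filter.Eventually.mono hq fun n hn => ?_))
    · congr 1
      funext i
      rcases i with i | i <;> rfl
    · refine (iff_of_eq ?_).1 hn
      show Formula.Realize _ _ = _
      congr 1
      funext i
      rcases i with i | i <;> rfl
  · rintro q - hq ⟨N, SN, j, b, h⟩
    have h₁ := h q (Set.mem_insert _ _)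
    have h₂ := h ⟨q.1, q.2.1.not, q.2.2⟩ (Set.mem_insert_of_mem _
      ((Ultrafilter.eventually_not.2 hq).mono fun n hn => Formula.realize_not.2 hn))
    exact (@Formula.realize_not L N SN _ q.2.1 _).1 h₂ h₁

/-- The formula coded by `d` refines the formula coded by `c`, is infinite, decides the formula
coded by `s` and is incompatible with the `s`-th type in the list coded by `X`. -/
def Refines (g : GoedelCoding L) (M : CodedStructure L) (X : Set ℕ) (s c d : ℕ) : Prop :=
  (∀ m, ∃ x, m < x ∧ CodeSat g M x d) ∧
  (∀ x, CodeSat g M x d → CodeSat g M x c) ∧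
  ((∀ x, CodeSat g M x d → CodeSat g M x s) ∨ (∀ x, CodeSat g M x d → ¬ CodeSat g M x s)) ∧
  ∃ e, (¬ Nat.pair 1 (Nat.pair s e) ∈ X ∧ ∀ x, CodeSat g M x d → CodeSat g M x e) ∨
    (Nat.pair 1 (Nat.pair s e) ∈ X ∧ ∀ x, CodeSat g M x d → ¬ CodeSat g M x e)

theorem arithRel_refines {g : GoedelCoding L} {M : CodedStructure L} (hM : ArithDecidable g M)
    {X : Set ℕ} (hX : IsArithmetical X) :
    ArithRel fun v => Refines g M X (v 0) (v 1) (v 2) := by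
  have h : ∀ i j, ArithRel fun v => CodeSat g M (v i) (v j) := fun i j =>
    .subst₂ (arithRel_codeSat hM) (.var i) (.var j)
  have hX' : ∀ i j, ArithRel fun v => Nat.pair 1 (Nat.pair (v i) (v j)) ∈ X := fun i j =>
    .subst₁ (R := (· ∈ X)) (isArithmetical_iff.1 hX) (.pair .one (.pair (.var i) (.var j)))
  refine .and (.all (.ex (.and (.lt (.var 1) (.var 0)) (h 0 4)))) (.and ?_ (.and ?_ ?_))
  · exact .all (.imp (h 0 3) (h 0 2))
  · exact .or (.all (.imp (h 0 3) (h 0 1))) (.all (.imp (h 0 3) (.not (h 0 1))))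
  · exact .ex (.or (.and (.not (hX' 1 0)) (.all (.imp (h 0 4) (h 0 1))))
      (.and (hX' 1 0) (.all (.imp (h 0 4) (.not (h 0 1))))))

theorem infinite_holds_iff {g : GoedelCoding L} {M : CodedStructure L}
    {q : ParamFormula L M 1} :
    { x | q.Holds x }.Infinite ↔ ∀ m, ∃ x, m < x ∧ CodeSat g M x (pfCode g q) := by
  have h : { x | CodeSat g M x (pfCode g q) } = Subtype.val '' { x | q.Holds x } := by
    ext x
    constructor
    · intro hx
      have hx' := hx
      obtain ⟨hxM, -⟩ := hx'
      exact ⟨⟨x, hxM⟩, codeSat_pfCode (x := ⟨x, hxM⟩).1 hx, rfl⟩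
    · rintro ⟨x, hx, rfl⟩
      exact codeSat_pfCode.2 hx
  rw [← Set.infinite_image_iff Subtype.val_injective.injOn, ← h]
  constructor
  · intro h m
    obtain ⟨x, hx, hm⟩ := h.exists_gt m
    exact ⟨x, hm, hx⟩
  · intro h
    refine Set.infinite_of_forall_exists_gt fun m => ?_
    obtain ⟨x, hm, hx⟩ := h m
    exact ⟨x, hx, hm⟩

theorem exists_eq_pfCode {g : GoedelCoding L} {M : CodedStructure L} {x c : ℕ}
    (h : CodeSat g M x c) : ∃ q : ParamFormula L M 1, c = pfCode g q :=
  let ⟨_, q, hq, _⟩ := h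
  ⟨q, hq⟩

theorem CodeSat.mono {g : GoedelCoding L} {M : CodedStructure L} {q r : ParamFormula L M 1}
    (h : ∀ x, q.Holds x → r.Holds x) {x : ℕ} (hx : CodeSat g M x (pfCode g q)) :
    CodeSat g M x (pfCode g r) := by
  have hx' := hx
  obtain ⟨hxM, -⟩ := hx'
  exact codeSat_pfCode (x := ⟨x, hxM⟩).2 (h _ (codeSat_pfCode.1 hx))

theorem CodeSat.not_of_disjoint {g : GoedelCoding L} {M : CodedStructure L}
    {q r : ParamFormula L M 1} (h : ∀ x, q.Holds x → ¬ r.Holds x) {x : ℕ}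
    (hx : CodeSat g M x (pfCode g q)) : ¬ CodeSat g M x (pfCode g r) := by
  have hx' := hx
  obtain ⟨hxM, -⟩ := hx'
  exact fun hr => h ⟨x, hxM⟩ (codeSat_pfCode.1 hx) (codeSat_pfCode.1 hr)

/-- An infinite definable set has an infinite definable subset deciding a given formula. -/
theorem exists_infinite_deciding (g : GoedelCoding L) {M : CodedStructure L}
    {q : ParamFormula L M 1} (hq : { x | q.Holds x }.Infinite) (s : ℕ) :
    ∃ r : ParamFormula L M 1, { x | r.Holds x }.Infinite ∧ (∀ x, r.Holds x → q.Holds x) ∧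
      ((∀ x, CodeSat g M x (pfCode g r) → CodeSat g M x s) ∨
        (∀ x, CodeSat g M x (pfCode g r) → ¬ CodeSat g M x s)) := by
  by_cases hs : ∃ t : ParamFormula L M 1, s = pfCode g t
  · obtain ⟨t, rfl⟩ := hs
    obtain ⟨t', ht'⟩ := t.exists_holds_iff_not
    obtain ⟨r, hr⟩ := q.exists_holds_iff_and t
    obtain ⟨r', hr'⟩ := q.exists_holds_iff_and t'
    have hU : { x | q.Holds x } = { x | r.Holds x } ∪ { x | r'.Holds x } := by
      ext x
      simp only [Set.mem_union, Set.mem_ofPred_eq, hr, hr', ht']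
      tauto
    rw [hU, Set.infinite_union] at hq
    rcases hq with hq | hq
    · exact ⟨r, hq, fun x hx => ((hr x).1 hx).1,
        .inl fun x hx => hx.mono fun y hy => ((hr y).1 hy).2⟩
    · exact ⟨r', hq, fun x hx => ((hr' x).1 hx).1,
        .inr fun x hx => hx.not_of_disjoint fun y hy => (ht' y).1 ((hr' y).1 hy).2⟩
  · exact ⟨q, hq, fun _ h => h, .inr fun x _ hx => hs (exists_eq_pfCode hx)⟩

/-- In an arithmetically decidable infinite model of an arithmetically stable theory there is an
infinite definable set that is not split by any definable set into two infinite parts. -/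
theorem exists_minimal_formula {g : GoedelCoding L} {T : L.Theory} (hT : ArithStable g T)
    {M : CodedStructure L} (hdec : ArithDecidable g M) (hM : M.Models T)
    (hinf : Infinite ↥M.carrier) :
    ∃ q : ParamFormula L M 1, { x | q.Holds x }.Infinite ∧ ∀ r : ParamFormula L M 1,
      { x | q.Holds x ∧ r.Holds x }.Finite ∨ { x | q.Holds x ∧ ¬ r.Holds x }.Finite := by
  by_contra! hno
  have hsat : ∀ i j, ArithRel fun v => CodeSat g M (v i) (v j) := fun i j =>
    .subst₂ (arithRel_codeSat hdec) (.var i) (.var j)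
  obtain ⟨q₀, htop⟩ := ParamFormula.exists_holds_iff_true (M := M)
  have hcarrier : IsArithmetical M.carrier := by
    refine isArithmetical_iff.2 ((ArithRel.ex (R := fun v c => CodeSat g M (v 0) c)
      (hsat 1 0)).of_iff fun v => ?_)
    exact ⟨fun h => ⟨_, codeSat_pfCode (x := ⟨v 0, h⟩).2 (htop _)⟩, fun ⟨_, h, _⟩ => h⟩
  obtain ⟨X, hX, -, hlist⟩ := hT M hdec hM M.carrier subset_rfl hcarrier
  have hstep : ∀ s c, (∀ m, ∃ x, m < x ∧ CodeSat g M x c) → ∃ d, Refines g M X s c d := by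
    intro s c hc
    obtain ⟨x, -, hx⟩ := hc 0
    obtain ⟨q, rfl⟩ := exists_eq_pfCode hx
    rw [← infinite_holds_iff] at hc
    obtain ⟨r, hr₁, hr₂⟩ := hno q hc
    obtain ⟨r', hr'⟩ := r.exists_holds_iff_not
    obtain ⟨t, ht⟩ := q.exists_holds_iff_and r
    obtain ⟨t', ht'⟩ := q.exists_holds_iff_and r'
    by_cases hs : Nat.pair 1 (Nat.pair s (pfCode g r)) ∈ X
    · have hi : { x | t'.Holds x }.Infinite := by
        simpa only [ht', hr'] using hr₂
      obtain ⟨u, hu, hut, hus⟩ := exists_infinite_deciding g hi s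
      refine ⟨pfCode g u, infinite_holds_iff.1 hu, fun x hx => hx.mono fun y hy =>
        ((ht' y).1 (hut y hy)).1, hus, pfCode g r, .inr ⟨hs, fun x hx => hx.not_of_disjoint
        fun y hy => (hr' y).1 ((ht' y).1 (hut y hy)).2⟩⟩
    · have hi : { x | t.Holds x }.Infinite := by
        simpa only [ht] using hr₁
      obtain ⟨u, hu, hut, hus⟩ := exists_infinite_deciding g hi s
      exact ⟨pfCode g u, infinite_holds_iff.1 hu, fun x hx => hx.mono fun y hy =>
        ((ht y).1 (hut y hy)).1, hus, pfCode g r, .inl ⟨hs, fun x hx => hx.mono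
        fun y hy => ((ht y).1 (hut y hy)).2⟩⟩
  have htop' : { x | q₀.Holds x }.Infinite := by
    rw [Set.eq_univ_of_forall (s := { x | q₀.Holds x }) htop]
    exact Set.infinite_univ
  obtain ⟨F, hF, hFS⟩ := ArithRel.exists_sequence (arithRel_refines hdec hX)
    (infinite_holds_iff (g := g).1 htop') hstep fun s c d h => h.1
  have hanti : ∀ x n m, n ≤ m → CodeSat g M x (F m) → CodeSat g M x (F n) := by
    intro x n m hnm
    induction hnm with
    | refl => exact id
    | step _ ih => exact fun h => ih ((hFS _).2.1 x h)
  have hne : ∀ n, ∃ x : ↥M.carrier, CodeSat g M x (F n) := by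
    intro n
    obtain ⟨x, -, hx⟩ := (hFS n).1 0
    have hx' := hx
    obtain ⟨hxM, -⟩ := hx'
    exact ⟨⟨x, hxM⟩, (hFS n).2.1 x hx⟩
  choose x hx using hne
  have hcode : ∀ c, c ∈ typeCode g { q : ParamFormula L M 1 |
      ∀ᶠ n in (Filter.hyperfilter ℕ : Filter ℕ), q.Holds (x n) } ↔
      ∃ n, ∀ y, CodeSat g M y (F n) → CodeSat g M y c := by
    intro c
    constructor
    · rintro ⟨q, hq, rfl⟩
      refine ⟨pfCode g q + 1, ((hFS (pfCode g q)).2.2.1).resolve_right fun hdis => ?_⟩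
      have hgt := Filter.Eventually.filter_mono Nat.hyperfilter_le_atTop
        (Filter.eventually_gt_atTop (pfCode g q))
      obtain ⟨n, hn, hqn⟩ := (hgt.and hq).exists
      exact hdis _ (hanti _ _ _ hn (hx n)) (codeSat_pfCode.2 hqn)
    · rintro ⟨n, hn⟩
      obtain ⟨q, rfl⟩ := exists_eq_pfCode (hn _ (hx n))
      refine ⟨q, ?_, rfl⟩
      refine (Filter.Eventually.filter_mono Nat.hyperfilter_le_atTop
        (Filter.eventually_ge_atTop n)).mono fun m hm => ?_
      exact codeSat_pfCode.1 (hn _ (hanti _ _ _ hm (hx m)))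
  obtain ⟨i, hi⟩ := hlist 1 le_rfl _ (isNType_eventually_holds M x) (by
    refine isArithmetical_iff.2 ((ArithRel.ex (R := fun v n => ∃ y, y = F n ∧
      ∀ z, CodeSat g M z y → CodeSat g M z (v 0)) (.ex (.and
        (.eq (.var 0) (.subst₁ hF (.var 1))) (.all (.imp (hsat 0 1) (hsat 0 3)))))).of_iff
      fun v => (hcode _).trans ?_)
    simp)
  have hmem : ∀ e, Nat.pair 1 (Nat.pair i e) ∈ X ↔
      ∃ n, ∀ y, CodeSat g M y (F n) → CodeSat g M y e := fun e => by
    rw [← hcode, ← hi]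
    rfl
  obtain ⟨e, ⟨heX, he⟩ | ⟨heX, he⟩⟩ := (hFS i).2.2.2
  · exact heX ((hmem e).2 ⟨_, he⟩)
  · obtain ⟨n, hn⟩ := (hmem e).1 heX
    exact he _ (hanti _ _ _ (le_max_left (i + 1) n) (hx _))
      (hn _ (hanti _ _ _ (le_max_right (i + 1) n) (hx _)))

/-! ## From minimality to strong minimality -/

/-- The formula saying that `χ` has at least `n` solutions. -/
noncomputable def atLeast {β : Type} (n : ℕ) (χ : L.Formula (Fin 1 ⊕ β)) : L.Formula β :=
  Formula.iExs (Fin n) (Formula.iInf fun i : Fin n =>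
    χ.relabel (Sum.elim (fun _ => Sum.inr i) Sum.inl) ⊓
      Formula.iInf fun i' : { i' : Fin n // i' ≠ i } =>
        ((Term.var (Sum.inr i'.1)).equal (Term.var (Sum.inr i))).not)

theorem realize_atLeast {β N : Type} [L.Structure N] {n : ℕ} {χ : L.Formula (Fin 1 ⊕ β)}
    {b : β → N} : (atLeast n χ).Realize b ↔
      ∃ z : Fin n → N, Function.Injective z ∧ ∀ i, χ.Realize (Sum.elim (fun _ => z i) b) := by
  have hχ : ∀ (z : Fin n → N) (i : Fin n),
      Sum.elim b z ∘ Sum.elim (fun _ : Fin 1 => Sum.inr i) Sum.inl = Sum.elim (fun _ => z i) b := by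
    intro z i
    funext x
    rcases x with x | x <;> rfl
  simp only [atLeast, Formula.realize_iExs, Formula.realize_iInf, Formula.realize_inf,
    Formula.realize_relabel, hχ, Formula.realize_not, Formula.realize_equal, Term.realize_var,
    Sum.elim_inr, Subtype.forall]
  refine exists_congr fun z => ⟨fun h => ⟨fun i i' hii => ?_, fun i => (h i).1⟩,
    fun h i => ⟨h.2 i, fun i' hne heq => hne (h.1 heq)⟩⟩
  by_contra hne
  exact (h i').2 i hne hii

theorem realize_atLeast_of_infinite {β N : Type} [L.Structure N] {χ : L.Formula (Fin 1 ⊕ β)}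
    {b : β → N} (h : { x | χ.Realize (Sum.elim (fun _ => x) b) }.Infinite) (n : ℕ) :
    (atLeast n χ).Realize b := by
  have := h.to_subtype
  let e := Infinite.natEmbedding ↥{ x | χ.Realize (Sum.elim (fun _ => x) b) }
  exact realize_atLeast.2 ⟨fun i => e i, fun i i' hii =>
    Fin.ext (e.injective (Subtype.ext hii)), fun i => (e i).2⟩

theorem le_ncard_of_realize_atLeast {β N : Type} [L.Structure N] {χ : L.Formula (Fin 1 ⊕ β)}
    {b : β → N} {n : ℕ} (h : (atLeast n χ).Realize b)
    (hfin : { x | χ.Realize (Sum.elim (fun _ => x) b) }.Finite) :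
    n ≤ { x | χ.Realize (Sum.elim (fun _ => x) b) }.ncard := by
  obtain ⟨z, hz, hzχ⟩ := realize_atLeast.1 h
  have := Set.ncard_le_ncard (s := Set.range z) (by rintro _ ⟨i, rfl⟩; exact hzχ i) hfin
  rwa [← Set.image_univ, Set.ncard_image_of_injective _ hz, Set.ncard_univ, Nat.card_fin] at this

theorem exists_infinite_of_realize_atLeast {T : L.Theory} (hT : ¬ HasVaughtianPair T)
    {M : Type} [SM : L.Structure M] [Infinite M] (hM : ModelsT L T M SM) {β : Type} [Finite β]
    (χ : L.Formula (Fin 1 ⊕ β)) :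
    ∃ n, ∀ b : β → M, (atLeast n χ).Realize b →
      { x | χ.Realize (Sum.elim (fun _ => x) b) }.Infinite := by
  obtain ⟨k, ⟨e⟩⟩ := Finite.exists_equiv_fin β
  obtain ⟨n, hn⟩ := exists_ncard_lt_of_not_hasVaughtianPair hT hM (χ.relabel (Sum.map id e))
  refine ⟨n, fun b hb hfin => ?_⟩
  have heq : smSet L M SM (χ.relabel (Sum.map id e)) (b ∘ e.symm) =
      { x | χ.Realize (Sum.elim (fun _ => x) b) } := by
    ext x
    refine Formula.realize_relabel.trans (iff_of_eq ?_)
    show _ = χ.Realize _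
    congr 1
    funext i
    rcases i with i | i <;> simp
  have := hn (b ∘ e.symm) (heq ▸ hfin)
  rw [heq] at this
  exact absurd (le_ncard_of_realize_atLeast hb hfin) (not_le.2 this)

/-- The conjunction of two formulas in one object variable and disjoint parameter variables. -/
def conj {k m : ℕ} (φ : L.Formula (Fin 1 ⊕ Fin k)) (ψ : L.Formula (Fin 1 ⊕ Fin m)) :
    L.Formula (Fin 1 ⊕ (Fin k ⊕ Fin m)) :=
  φ.relabel (Sum.map id Sum.inl) ⊓ ψ.relabel (Sum.map id Sum.inr)

theorem realize_conj {N : Type} [L.Structure N] {k m : ℕ} {φ : L.Formula (Fin 1 ⊕ Fin k)}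
    {ψ : L.Formula (Fin 1 ⊕ Fin m)} {x : N} {p : Fin k → N} {b : Fin m → N} :
    (conj φ ψ).Realize (Sum.elim (fun _ => x) (Sum.elim p b)) ↔
      φ.Realize (Sum.elim (fun _ => x) p) ∧ ψ.Realize (Sum.elim (fun _ => x) b) := by
  rw [conj, Formula.realize_inf, Formula.realize_relabel, Formula.realize_relabel]
  refine iff_of_eq (congrArg₂ _ ?_ ?_)
  all_goals
    congr 1
    funext i
    rcases i with i | i <;> rfl

theorem stronglyMinimalOver_of_minimal {T : L.Theory} (hT : ¬ HasVaughtianPair T)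
    {M : CodedStructure L} (hM : M.Models T) (hinf : Infinite ↥M.carrier)
    {q : ParamFormula L M 1} (hq : { x | q.Holds x }.Infinite)
    (hmin : ∀ r : ParamFormula L M 1,
      { x | q.Holds x ∧ r.Holds x }.Finite ∨ { x | q.Holds x ∧ ¬ r.Holds x }.Finite) :
    StronglyMinimalOver T M q.2.1 q.2.2 := by
  refine ⟨hq, fun N SN _ j Y hY hYsub => ?_⟩
  let := M.struc
  obtain ⟨k, φ, p⟩ := q
  obtain ⟨m, ψ, b, rfl⟩ := hY
  by_contra! hcon
  obtain ⟨h₁, h₂⟩ := hcon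
  obtain ⟨n₁, hn₁⟩ := exists_infinite_of_realize_atLeast hT hM (conj φ ψ)
  obtain ⟨n₂, hn₂⟩ := exists_infinite_of_realize_atLeast hT hM (conj φ ψ.not)
  let j' : ↥M.carrier ↪ₑ[L] N := j
  have hΘ : (Formula.iExs (Fin m) (atLeast n₁ (conj φ ψ) ⊓ atLeast n₂ (conj φ ψ.not))).Realize
      (j' ∘ p) := by
    rw [Formula.realize_iExs]
    refine ⟨b, Formula.realize_inf.2 ⟨realize_atLeast_of_infinite (h₁.mono fun x hx => ?_) _,
      realize_atLeast_of_infinite (h₂.mono fun x hx => ?_) _⟩⟩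
    · exact realize_conj.2 ⟨hYsub hx, hx⟩
    · exact realize_conj.2 ⟨hx.1, Formula.realize_not.2 hx.2⟩
  rw [j'.map_formula, Formula.realize_iExs] at hΘ
  obtain ⟨b', hb'⟩ := hΘ
  rw [Formula.realize_inf] at hb'
  rcases hmin ⟨m, ψ, b'⟩ with h | h
  · refine hn₁ _ hb'.1 (h.subset fun x hx => ?_)
    exact realize_conj.1 hx
  · refine hn₂ _ hb'.2 (h.subset fun x hx => ?_)
    exact (realize_conj.1 hx).imp_right Formula.realize_not.1

/-- **Existence of a strongly minimal formula** over an arithmetically decidable prime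
model, assuming arithmetical stability and no Vaughtian pairs. -/
theorem exists_strongly_minimal_formula
    (L : FirstOrder.Language) (g : GoedelCoding L) (hL : ArithLang g)
    (T : L.Theory) (hT : ArithTheory g T) (hcomp : T.IsComplete)
    (hnf : NoFiniteModels L T)
    (hstab : ArithStable g T) (hnvp : ¬ HasVaughtianPair T)
    (P : CodedStructure L) (hPdec : ArithDecidable g P) (hP : PrimeModel L T P) :
    ∃ (k : ℕ) (φ : L.Formula (Fin 1 ⊕ Fin k)) (p : Fin k → ↥P.carrier),
      StronglyMinimalOver T P φ p := by
  have hinf : Infinite ↥P.carrier := hnf _ P.struc hP.1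
  obtain ⟨q, hq, hmin⟩ := exists_minimal_formula hstab hPdec hP.1 hinf
  exact ⟨q.1, q.2.1, q.2.2, stronglyMinimalOver_of_minimal hnvp hP.1 hinf hq hmin⟩

end ArMorley
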